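/- Let B be a separable unital C*-algebra and let M ⊆ B be a norm-closed linear subspace. For each x ∈ M with ‖x‖ = 1, let S_x = {φ : φ is a state on B with φ(x*x) = 1}. Fix u ∈ M with ‖u‖ = 1 and ε > 0. Then the set D = {x ∈ M : ‖x‖ = 1 and Re(φ(u*x) − ψ(u*x)) < ε for every φ, ψ ∈ S_x} is open and dense in the unit sphere {x ∈ M : ‖x‖ = 1} of M, with respect to the norm topology. -/

import Mathlib

noncomputable section

open scoped ComplexOrder

variable {B : Type*} [NormedRing B] [StarRing B] [CStarRing B] [NormedAlgebra ℂ B]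
  [StarModule ℂ B] [CompleteSpace B]

/-- A state on `B`: a unital contractive linear functional. -/
def IsState (φ : B →ₗ[ℂ] ℂ) : Prop :=
  φ 1 = 1 ∧ ∀ b : B, ‖φ b‖ ≤ ‖b‖

open Filter Topology

omit [CompleteSpace B] in
theorem IsState.im_eq_zero {φ : B →ₗ[ℂ] ℂ} (hφ : IsState φ) {a : B} (ha : star a = a) :
    (φ a).im = 0 := by
  have : Nontrivial B := by
    refine ⟨1, 0, fun h => ?_⟩
    have h1 := hφ.1
    rw [h, map_zero] at h1
    exact zero_ne_one h1
  have key (s : ℝ) : ((φ a).im + s) ^ 2 ≤ ‖a‖ ^ 2 + s ^ 2 := by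
    set b : B := a + ((s : ℂ) * Complex.I) • (1 : B) with hb
    have hφb : φ b = φ a + s * Complex.I := by simp [hb, hφ.1]
    have hbb : star b * b = a * a + ((s ^ 2 : ℝ) : ℂ) • (1 : B) := by
      have hI : (s : ℂ) * Complex.I * (s * Complex.I) = -(s : ℂ) ^ 2 := by
        linear_combination (s : ℂ) ^ 2 * Complex.I_sq
      simp only [hb, star_add, star_smul, star_one, ha, add_mul, mul_add, mul_smul_comm,
        mul_one, star_mul', Complex.star_def, Complex.conj_I, Complex.conj_ofReal, mul_neg,
        neg_smul]
      push_cast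
      simp [smul_smul, hI]
    have h1 : ‖b‖ ^ 2 ≤ ‖a‖ ^ 2 + s ^ 2 := by
      rw [sq, ← CStarRing.norm_star_mul_self, hbb]
      refine (norm_add_le _ _).trans (add_le_add ?_ ?_)
      · rw [sq]
        exact norm_mul_le a a
      · rw [norm_smul, CStarRing.norm_one, mul_one, Complex.norm_real, Real.norm_eq_abs,
          abs_of_nonneg (sq_nonneg s)]
    have h2 : |(φ b).im| ≤ ‖b‖ := (Complex.abs_im_le_norm _).trans (hφ.2 b)
    have h3 : (φ b).im = (φ a).im + s := by simp [hφb]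
    rw [← h3, ← sq_abs]
    exact (pow_le_pow_left₀ (abs_nonneg _) h2 2).trans h1
  by_contra h
  have hs := key (‖a‖ ^ 2 / (φ a).im)
  have h1 : (φ a).im * (‖a‖ ^ 2 / (φ a).im) = ‖a‖ ^ 2 := by field_simp
  have h2 : 0 < (φ a).im ^ 2 := by positivity
  nlinarith [sq_nonneg ‖a‖]

omit [CompleteSpace B] in
theorem IsState.re_star {φ : B →ₗ[ℂ] ℂ} (hφ : IsState φ) (a : B) :
    (φ (star a)).re = (φ a).re := by
  have h : (φ (Complex.I • (a - star a))).im = 0 := by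
    refine hφ.im_eq_zero ?_
    simp only [star_smul, star_sub, star_star, Complex.star_def, Complex.conj_I, neg_smul,
      ← smul_neg, neg_sub]
  simp only [map_smul, map_sub, smul_eq_mul, Complex.mul_im, Complex.I_re, Complex.I_im,
    Complex.sub_re, Complex.sub_im, zero_mul, one_mul, zero_add] at h
  linarith

omit [StarModule ℂ B] [CompleteSpace B] in
theorem IsState.re_apply_star_mul_self_le {φ : B →ₗ[ℂ] ℂ} (hφ : IsState φ) (a : B) :
    (φ (star a * a)).re ≤ ‖a‖ ^ 2 := by
  rw [sq, ← CStarRing.norm_star_mul_self]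
  exact (Complex.re_le_norm _).trans (hφ.2 _)

omit [CompleteSpace B] in
theorem IsState.re_apply_star_add_smul_mul_self {φ : B →ₗ[ℂ] ℂ} (hφ : IsState φ) (z u : B)
    (r : ℝ) :
    (φ (star (z + (r : ℂ) • u) * (z + (r : ℂ) • u))).re =
      (φ (star z * z)).re + 2 * r * (φ (star u * z)).re + r ^ 2 * (φ (star u * u)).re := by
  have h := hφ.re_star (star u * z)
  rw [star_mul, star_star] at h
  simp only [star_add, star_smul, Complex.star_def, Complex.conj_ofReal, add_mul, mul_add,
    smul_mul_assoc, mul_smul_comm, map_add, map_smul, smul_eq_mul,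
    Complex.add_re, Complex.re_ofReal_mul, h]
  ring

omit [CompleteSpace B] in
/-- A state attaining `‖z‖ ^ 2` at `star z * z` determines the directional derivative of the
squared norm at `z`. -/
theorem IsState.two_mul_re_eq_of_hasDerivAt {φ : B →ₗ[ℂ] ℂ} (hφ : IsState φ) {z u : B} {c : ℝ}
    (hz : (φ (star z * z)).re = ‖z‖ ^ 2)
    (hc : HasDerivAt (fun r : ℝ => ‖z + (r : ℂ) • u‖ ^ 2) c 0) :
    2 * (φ (star u * z)).re = c := by
  have hq : HasDerivAt (fun r : ℝ => (φ (star z * z)).re + 2 * r * (φ (star u * z)).re +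
      r ^ 2 * (φ (star u * u)).re) (2 * (φ (star u * z)).re) 0 := by
    have h1 := ((hasDerivAt_id (0 : ℝ)).const_mul 2).mul_const (φ (star u * z)).re
    have h2 := ((hasDerivAt_id (0 : ℝ)).pow 2).mul_const (φ (star u * u)).re
    exact ((h1.const_add (φ (star z * z)).re).add h2).congr_deriv (by simp)
  have hmin : IsLocalMin ((fun r : ℝ => ‖z + (r : ℂ) • u‖ ^ 2) -
      fun r : ℝ => (φ (star z * z)).re + 2 * r * (φ (star u * z)).re +
        r ^ 2 * (φ (star u * u)).re) 0 := by
    refine Eventually.of_forall fun r => ?_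
    have h := hφ.re_apply_star_mul_self_le (z + (r : ℂ) • u)
    rw [hφ.re_apply_star_add_smul_mul_self] at h
    simp only [Pi.sub_apply, Complex.ofReal_zero, zero_smul, add_zero, hz] at h ⊢
    linarith
  have := hmin.hasDerivAt_eq_zero (hc.sub hq)
  linarith

omit [StarRing B] [CStarRing B] [StarModule ℂ B] [CompleteSpace B] in
theorem dense_differentiableAt_norm_add_smul (x u : B) :
    Dense {t : ℝ | DifferentiableAt ℝ (fun s : ℝ => ‖x + (s : ℂ) • u‖) t} := by
  have hlip : LipschitzWith ‖u‖₊ (fun s : ℝ => ‖x + (s : ℂ) • u‖) := by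
    refine LipschitzWith.of_dist_le_mul fun s t => ?_
    rw [Real.dist_eq, Real.dist_eq, coe_nnnorm]
    refine (abs_norm_sub_norm_le _ _).trans_eq ?_
    rw [add_sub_add_left_eq_sub, ← sub_smul, norm_smul, ← Complex.ofReal_sub, Complex.norm_real,
      Real.norm_eq_abs, mul_comm]
  exact MeasureTheory.Measure.dense_of_ae hlip.ae_differentiableAt_real

omit [StarRing B] [CStarRing B] [StarModule ℂ B] [CompleteSpace B] in
theorem exists_isState_tendsto {ι : Type*} (F : Ultrafilter ι) (φ : ι → B →ₗ[ℂ] ℂ)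
    (hφ : ∀ i, IsState (φ i)) :
    ∃ L : B →ₗ[ℂ] ℂ, IsState L ∧ ∀ (a : ι → B) (b : B), Tendsto a F (𝓝 b) →
      Tendsto (fun i => φ i (a i)) F (𝓝 (L b)) := by
  have hlim (b : B) : ∃ l ∈ Metric.closedBall (0 : ℂ) ‖b‖, Tendsto (fun i => φ i b) F (𝓝 l) :=
    (isCompact_closedBall (0 : ℂ) ‖b‖).ultrafilter_le_nhds (F.map fun i => φ i b) <|
      le_principal_iff.2 <| Eventually.of_forall (f := (F : Filter ι)) fun i =>
        mem_closedBall_zero_iff.2 ((hφ i).2 b)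
  choose f hf hft using hlim
  let L : B →ₗ[ℂ] ℂ := linearMapOfTendsto f φ (tendsto_pi_nhds.2 hft)
  refine ⟨L, ⟨?_, fun b => mem_closedBall_zero_iff.1 (hf b)⟩, fun a b hab => ?_⟩
  · refine tendsto_nhds_unique (hft 1) ?_
    simp only [(hφ _).1]
    exact tendsto_const_nhds
  · have h0 : Tendsto (fun i => φ i (a i - b)) F (𝓝 0) :=
      squeeze_zero_norm (fun i => (hφ i).2 _) (tendsto_iff_norm_sub_tendsto_zero.1 hab)
    have h1 := h0.add (hft b)
    simp only [map_sub, sub_add_cancel, zero_add] at h1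
    exact h1

theorem stmt13 [TopologicalSpace.SeparableSpace B]
    (M : Submodule ℂ B) (hMclosed : IsClosed (M : Set B))
    (u : B) (huM : u ∈ M) (hu : ‖u‖ = 1) (ε : ℝ) (hε : 0 < ε)
    (D : Set B)
    (hD : D = {x : B | x ∈ M ∧ ‖x‖ = 1 ∧
      ∀ φ ψ : B →ₗ[ℂ] ℂ, IsState φ → IsState ψ →
        φ (star x * x) = 1 → ψ (star x * x) = 1 →
        (φ (star u * x) - ψ (star u * x)).re < ε}) :
    IsOpen ((↑) ⁻¹' D : Set {x : B // x ∈ M ∧ ‖x‖ = 1}) ∧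
      {x : B | x ∈ M ∧ ‖x‖ = 1} ⊆ closure D := by
  subst hD
  constructor
  · rw [← isClosed_compl_iff, isClosed_iff_ultrafilter]
    intro x F hFx hF hx
    let p : (B →ₗ[ℂ] ℂ) → (B →ₗ[ℂ] ℂ) → {x : B // x ∈ M ∧ ‖x‖ = 1} → Prop := fun φ ψ y =>
      φ (star (y : B) * y) = 1 ∧ ψ (star (y : B) * y) = 1 ∧
        ε ≤ (φ (star u * y) - ψ (star u * y)).re
    have hbad : ∀ y ∈ ((↑) ⁻¹' {x : B | x ∈ M ∧ ‖x‖ = 1 ∧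
        ∀ φ ψ : B →ₗ[ℂ] ℂ, IsState φ → IsState ψ →
          φ (star x * x) = 1 → ψ (star x * x) = 1 →
          (φ (star u * x) - ψ (star u * x)).re < ε} : Set {x : B // x ∈ M ∧ ‖x‖ = 1})ᶜ,
        ∃ φ ψ : B →ₗ[ℂ] ℂ, IsState φ ∧ IsState ψ ∧ p φ ψ y := by
      intro y hy
      by_contra! hcon
      refine hy ⟨y.2.1, y.2.2, fun φ ψ hφ hψ h1 h2 => ?_⟩
      by_contra! h3
      exact hcon φ ψ hφ hψ ⟨h1, h2, h3⟩
    obtain ⟨y₀, hy₀⟩ := F.nonempty_of_mem hF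
    obtain ⟨φ₀, -, hφ₀, -⟩ := hbad y₀ hy₀
    have hsel (y : {x : B // x ∈ M ∧ ‖x‖ = 1}) : ∃ φ ψ : B →ₗ[ℂ] ℂ, IsState φ ∧ IsState ψ ∧
        ((∃ φ ψ : B →ₗ[ℂ] ℂ, IsState φ ∧ IsState ψ ∧ p φ ψ y) → p φ ψ y) := by
      by_cases h : ∃ φ ψ : B →ₗ[ℂ] ℂ, IsState φ ∧ IsState ψ ∧ p φ ψ y
      · obtain ⟨φ, ψ, hφ, hψ, hp⟩ := h
        exact ⟨φ, ψ, hφ, hψ, fun _ => hp⟩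
      · exact ⟨φ₀, φ₀, hφ₀, hφ₀, fun h' => absurd h' h⟩
    choose φ ψ hφ hψ hp using hsel
    have hev : ∀ᶠ y in F, p (φ y) (ψ y) y := by
      filter_upwards [hF] with y hy using hp y (hbad y hy)
    obtain ⟨L, hL, hLt⟩ := exists_isState_tendsto F φ hφ
    obtain ⟨N, hN, hNt⟩ := exists_isState_tendsto F ψ hψ
    have hcoe : Tendsto (fun y : {x : B // x ∈ M ∧ ‖x‖ = 1} => (y : B)) F (𝓝 (x : B)) :=
      (continuous_subtype_val.tendsto x).mono_left hFx
    have hsq := (continuous_star.tendsto (x : B)).comp hcoe |>.mul hcoe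
    have hu' := hcoe.const_mul (star u)
    have h1 : L (star (x : B) * x) = 1 := by
      refine tendsto_nhds_unique (hLt _ _ hsq) (tendsto_const_nhds.congr' ?_)
      filter_upwards [hev] with y hy using hy.1.symm
    have h2 : N (star (x : B) * x) = 1 := by
      refine tendsto_nhds_unique (hNt _ _ hsq) (tendsto_const_nhds.congr' ?_)
      filter_upwards [hev] with y hy using hy.2.1.symm
    refine (hx.2.2 L N hL hN h1 h2).not_ge ?_
    refine ge_of_tendsto ((Complex.continuous_re.tendsto _).comp
      ((hLt _ _ hu').sub (hNt _ _ hu'))) ?_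
    filter_upwards [hev] with y hy using hy.2.2
  · rintro x ⟨hxM, hx⟩
    have hcont : Continuous fun t : ℝ => x + (t : ℂ) • u := by fun_prop
    have hne : ∀ᶠ t : ℝ in 𝓝 0, ‖x + (t : ℂ) • u‖ ≠ 0 :=
      hcont.norm.continuousAt.eventually_ne (by simp [hx])
    have hlim : Tendsto (fun t : ℝ => ((‖x + (t : ℂ) • u‖⁻¹ : ℝ) : ℂ) • (x + (t : ℂ) • u))
        (𝓝 0) (𝓝 x) := by
      have h0 : ContinuousAt
          (fun t : ℝ => ((‖x + (t : ℂ) • u‖⁻¹ : ℝ) : ℂ) • (x + (t : ℂ) • u)) 0 :=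
        (Complex.continuous_ofReal.continuousAt.comp
          (hcont.norm.continuousAt.inv₀ (by simp [hx]))).smul hcont.continuousAt
      simpa [ContinuousAt, hx] using h0
    have hfreq := (mem_closure_iff_frequently.1
      (dense_differentiableAt_norm_add_smul x u 0)).and_eventually hne
    refine mem_closure_iff_frequently.2 (hlim.frequently (hfreq.mono ?_))
    rintro t ⟨hdiff, hzne⟩
    have hshift : HasDerivAt (fun r : ℝ => ‖(x + (t : ℂ) • u) + (r : ℂ) • u‖ ^ 2)
        (deriv (fun s : ℝ => ‖x + (s : ℂ) • u‖ ^ 2) t) 0 := by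
      have h : HasDerivAt (fun s : ℝ => ‖x + (s : ℂ) • u‖ ^ 2)
          (deriv (fun s : ℝ => ‖x + (s : ℂ) • u‖ ^ 2) t) (t + 0) := by
        rw [add_zero]
        exact (DifferentiableAt.pow hdiff 2).hasDerivAt
      simpa only [Complex.ofReal_add, add_smul, add_assoc] using h.comp_const_add t 0
    set z : B := x + (t : ℂ) • u with hz
    have hnorm (φ : B →ₗ[ℂ] ℂ)
        (h1 : φ (star (((‖z‖⁻¹ : ℝ) : ℂ) • z) * (((‖z‖⁻¹ : ℝ) : ℂ) • z)) = 1) :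
        (φ (star z * z)).re = ‖z‖ ^ 2 := by
      have h2 := congrArg Complex.re h1
      simp only [star_smul, Complex.star_def, Complex.conj_ofReal, smul_mul_assoc,
        mul_smul_comm, map_smul, smul_eq_mul, Complex.re_ofReal_mul, Complex.one_re] at h2
      field_simp at h2
      exact h2
    refine ⟨M.smul_mem _ (M.add_mem hxM (M.smul_mem _ huM)), ?_, fun φ ψ hφ hψ h1 h2 => ?_⟩
    · rw [norm_smul, Complex.norm_real, norm_inv, norm_norm, inv_mul_cancel₀ hzne]
    · have e1 := hφ.two_mul_re_eq_of_hasDerivAt (hnorm φ h1) hshift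
      have e2 := hψ.two_mul_re_eq_of_hasDerivAt (hnorm ψ h2) hshift
      have e : (φ (star u * z)).re = (ψ (star u * z)).re := by linarith
      simpa only [mul_smul_comm, map_smul, smul_eq_mul, Complex.sub_re, Complex.re_ofReal_mul,
        e, sub_self] using hε
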